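/- Let P : ℝ^n → ℝ be convex and differentiable with ∇P Lipschitz continuous with constant h > 0. Decompose ℝ^n = ℝ^{n_1} × ⋯ × ℝ^{n_N}; for each i = 1,…,N let q_i : ℝ^{n_i} → (−∞, +∞] be proper, lower semicontinuous, and convex, and set Q(λ) = Σ_{i=1}^N q_i(λ_i) and Ψ = P + Q. Let λ* ∈ ℝ^n be a minimizer of Ψ. Let D ∈ ℕ and τ : ℕ → ℕ satisfy 0 ≤ k − τ(k) ≤ D for all k (communication delays bounded by D). Suppose the step-sizes c_i > 0 satisfy 1/c_i ≥ h(D+1)² for each i, and let {λ(k)}_{k∈ℕ} be generated blockwise by the asynchronous dual proximal gradient iteration λ_i(k+1) = prox^{c_i}_{q_i}[ λ_i(k) − c_i ∇_{λ_i} P(λ(τ(k))) ] from an initial point λ(0) with Ψ(λ(0)) finite. Then for every integer K with K ≥ ⌈D/2⌉, Ψ(λ(K+1)) − Ψ(λ*) ≤ Λ/(K+1), where Λ = Σ_{k=0}^{⌊D/2⌋} Σ_{i=1}^N ( h(2k + D)(D+1)²/4 − k/c_i ) ‖λ_i(k+1) − λ_i(k)‖² + Σ_{i=1}^N (1/(2c_i))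 ‖λ_i(0) − λ*_i‖². -/

import Mathlib

open scoped RealInnerProductSpace
open Finset

noncomputable section

/-- A proper extended-real-valued function: never `⊥` and not identically `⊤`. -/
def ProperE {E : Type*} (f : E → EReal) : Prop :=
  (∀ x, f x ≠ ⊥) ∧ (∃ x, f x ≠ ⊤)

/-- Convexity for extended-real-valued functions. -/
def ERealConvexOn {E : Type*} [AddCommGroup E] [Module ℝ E] (f : E → EReal) : Prop :=
  ∀ x y : E, ∀ a b : ℝ, 0 ≤ a → 0 ≤ b → a + b = 1 →
    f (a • x + b • y) ≤ (a : EReal) * f x + (b : EReal) * f y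

/-- The block decomposition `ℝ^n = ℝ^{n_1} × ⋯ × ℝ^{n_N}` with the Euclidean norm. -/
abbrev Blk {N : ℕ} (dims : Fin N → ℕ) :=
  PiLp 2 (fun i : Fin N => EuclideanSpace ℝ (Fin (dims i)))

theorem EReal.coe_finset_sum {ι : Type*} (s : Finset ι) (f : ι → ℝ) :
    ((∑ i ∈ s, f i : ℝ) : EReal) = ∑ i ∈ s, (f i : EReal) := by
  induction s using Finset.cons_induction with
  | empty => simp
  | cons a s ha ih => simp [Finset.sum_cons, EReal.coe_add, ih]

theorem EReal.finset_sum_ne_bot {ι : Type*} (s : Finset ι) (f : ι → EReal)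
    (hf : ∀ i ∈ s, f i ≠ ⊥) : ∑ i ∈ s, f i ≠ ⊥ := by
  induction s using Finset.cons_induction with
  | empty => simp
  | cons a s ha ih =>
    rw [Finset.sum_cons, EReal.add_ne_bot_iff]
    exact ⟨hf a (by simp), ih fun i hi => hf i (by simp [hi])⟩

theorem EReal.ne_top_of_finset_sum_ne_top {ι : Type*} (s : Finset ι) (f : ι → EReal)
    (hf : ∀ i ∈ s, f i ≠ ⊥) (hs : ∑ i ∈ s, f i ≠ ⊤) {i : ι} (hi : i ∈ s) : f i ≠ ⊤ := by
  classical
  rw [← Finset.add_sum_erase s f hi] at hs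
  exact ((EReal.add_ne_top_iff_ne_top₂ (hf i hi)
    (EReal.finset_sum_ne_bot _ _ fun j hj => hf j (Finset.mem_of_mem_erase hj))).1 hs).1

section Gradient

variable {E : Type*} [NormedAddCommGroup E] [InnerProductSpace ℝ E] [CompleteSpace E]
  {P : E → ℝ} {gradP : E → E}

theorem HasGradientAt.hasDerivAt_lineMap (hP : ∀ x, HasGradientAt P (gradP x) x) (x y : E)
    (t : ℝ) : HasDerivAt (fun s : ℝ => P (AffineMap.lineMap x y s))
      ⟪gradP (AffineMap.lineMap x y t), y - x⟫ t := by
  have h := (hP (AffineMap.lineMap x y t)).hasFDerivAt.comp_hasDerivAt t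
    (AffineMap.hasDerivAt_lineMap (a := x) (b := y))
  simpa [Function.comp_def] using h

/-- The first-order characterization of convexity. -/
theorem ConvexOn.add_inner_gradient_le (hPconv : ConvexOn ℝ Set.univ P)
    (hP : ∀ x, HasGradientAt P (gradP x) x) (x y : E) :
    P x + ⟪gradP x, y - x⟫ ≤ P y := by
  have hd := HasGradientAt.hasDerivAt_lineMap hP x y 0
  have hc : ConvexOn ℝ Set.univ (fun s : ℝ => P (AffineMap.lineMap x y s)) := by
    simpa [Function.comp_def] using hPconv.comp_affineMap (AffineMap.lineMap x y : ℝ →ᵃ[ℝ] E)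
  have := hc.le_slope_of_hasDerivAt (Set.mem_univ 0) (Set.mem_univ 1) one_pos hd
  simp [slope_def_field] at this
  simp only [inner_sub_right] at this ⊢
  linarith

/-- The descent lemma for functions with Lipschitz continuous gradient. -/
theorem HasGradientAt.le_add_inner_add_norm_sq {h : ℝ} (hP : ∀ x, HasGradientAt P (gradP x) x)
    (hLip : ∀ u v, ‖gradP u - gradP v‖ ≤ h * ‖u - v‖) (x y : E) :
    P y ≤ P x + ⟪gradP x, y - x⟫ + h / 2 * ‖y - x‖ ^ 2 := by
  have hd (t : ℝ) : HasDerivAt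
      (fun s : ℝ => P (AffineMap.lineMap x y s) - (s * ⟪gradP x, y - x⟫
        + h / 2 * ‖y - x‖ ^ 2 * s ^ 2))
      (⟪gradP (AffineMap.lineMap x y t), y - x⟫ - (⟪gradP x, y - x⟫
        + h * ‖y - x‖ ^ 2 * t)) t := by
    refine ((HasGradientAt.hasDerivAt_lineMap hP x y t).sub
      (((hasDerivAt_id t).mul_const _).add (((hasDerivAt_id t).pow 2).const_mul _))).congr_deriv ?_
    simp
    ring
  have hanti := antitoneOn_of_deriv_nonpos (convex_Icc (0 : ℝ) 1)
    (fun t _ => (hd t).continuousAt.continuousWithinAt)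
    (fun t _ => (hd t).differentiableAt.differentiableWithinAt) (by
      intro t ht
      rw [interior_Icc] at ht
      rw [(hd t).deriv]
      have h1 := real_inner_le_norm (gradP (AffineMap.lineMap x y t) - gradP x) (y - x)
      have h2 := hLip (AffineMap.lineMap x y t) x
      have h3 : ‖(AffineMap.lineMap x y t : E) - x‖ = t * ‖y - x‖ := by
        simp [AffineMap.lineMap_apply, norm_smul, abs_of_pos ht.1]
      rw [h3] at h2
      have h4 := mul_le_mul_of_nonneg_right h2 (norm_nonneg (y - x))
      rw [inner_sub_left] at h1
      nlinarith)
  have := hanti (Set.left_mem_Icc.2 zero_le_one) (Set.right_mem_Icc.2 zero_le_one) zero_le_one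
  simp at this
  linarith

end Gradient

/-- The variational inequality characterizing the proximal point `u` of `w`. -/
theorem ERealConvexOn.sub_le_inner_of_isProx {E : Type*} [NormedAddCommGroup E]
    [InnerProductSpace ℝ E] {q : E → EReal} (hq : ERealConvexOn q) {c : ℝ} (hc : 0 < c) {u w : E}
    (hu : ∀ v, q u + ((1 / (2 * c) * ‖u - w‖ ^ 2 : ℝ) : EReal)
      ≤ q v + ((1 / (2 * c) * ‖v - w‖ ^ 2 : ℝ) : EReal))
    {v : E} {p r : ℝ} (hp : q u = p) (hr : q v = r) :
    p - r ≤ 1 / c * ⟪u - w, v - u⟫ := by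
  have key (t : ℝ) (ht : t ∈ Set.Ioo (0 : ℝ) 1) :
      p - r ≤ 1 / c * ⟪u - w, v - u⟫ + t * (1 / (2 * c) * ‖v - u‖ ^ 2) := by
    have h1 := hu ((1 - t) • u + t • v)
    have h2 := hq u v (1 - t) t (by linarith [ht.2]) ht.1.le (by ring)
    have h3 := h1.trans (add_le_add_left h2 _)
    rw [hp, hr] at h3
    norm_cast at h3
    have h4 : (1 - t) • u + t • v - w = (u - w) + t • (v - u) := by module
    rw [h4, norm_add_sq_real, inner_smul_right, norm_smul, mul_pow, Real.norm_eq_abs, sq_abs] at h3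
    have h5 : t * (p - r) ≤
        t * (1 / c * ⟪u - w, v - u⟫ + t * (1 / (2 * c) * ‖v - u‖ ^ 2)) := by
      have : 1 / c = 2 * (1 / (2 * c)) := by field_simp
      rw [this]
      linarith
    exact le_of_mul_le_mul_left h5 ht.1
  have hlim : Filter.Tendsto
      (fun t : ℝ => 1 / c * ⟪u - w, v - u⟫ + t * (1 / (2 * c) * ‖v - u‖ ^ 2))
      (nhdsWithin 0 (Set.Ioi 0)) (nhds (1 / c * ⟪u - w, v - u⟫)) := by
    have : Continuous
        (fun t : ℝ => 1 / c * ⟪u - w, v - u⟫ + t * (1 / (2 * c) * ‖v - u‖ ^ 2)) := by fun_prop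
    simpa using (this.tendsto 0).mono_left nhdsWithin_le_nhds
  refine ge_of_tendsto hlim ?_
  filter_upwards [Ioo_mem_nhdsGT (zero_lt_one' ℝ)] with t ht using key t ht

theorem norm_sub_sq_le_sum_Icc {E : Type*} [SeminormedAddCommGroup E] (x : ℕ → E)
    {D k l : ℕ} (hlk : l ≤ k) (hD : k - l ≤ D) :
    ‖x (k + 1) - x l‖ ^ 2 ≤ (D + 1) * ∑ j ∈ Icc (k - D) k, ‖x (j + 1) - x j‖ ^ 2 := by
  rw [← Finset.sum_Icc_sub hlk x]
  calc ‖∑ j ∈ Icc l k, (x (j + 1) - x j)‖ ^ 2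
      ≤ (∑ j ∈ Icc l k, ‖x (j + 1) - x j‖) ^ 2 := by
        gcongr
        exact norm_sum_le _ _
    _ ≤ #(Icc l k) * ∑ j ∈ Icc l k, ‖x (j + 1) - x j‖ ^ 2 := sq_sum_le_card_mul_sum_sq
    _ ≤ (D + 1) * ∑ j ∈ Icc (k - D) k, ‖x (j + 1) - x j‖ ^ 2 := by
        refine mul_le_mul ?_ (Finset.sum_le_sum_of_subset_of_nonneg
          (Finset.Icc_subset_Icc_left (by omega)) fun _ _ _ => sq_nonneg _)
          (Finset.sum_nonneg fun _ _ => sq_nonneg _) (by positivity)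
        rw [Nat.card_Icc]
        exact_mod_cast (by omega : k + 1 - l ≤ D + 1)

theorem sum_Icc_add_one_cast (j D : ℕ) :
    ∑ k ∈ Icc j (j + D), ((k : ℝ) + 1) = (D + 1) * (2 * j + 2 + D) / 2 := by
  induction D with
  | zero => simp; ring
  | succ D ih =>
    rw [← add_assoc, Finset.sum_Icc_succ_top (by omega), ih]
    push_cast
    ring

theorem sum_mul_sum_Icc_le {a : ℕ → ℝ} (ha : ∀ j, 0 ≤ a j) (D n : ℕ) :
    ∑ k ∈ range n, ((k : ℝ) + 1) * ∑ j ∈ Icc (k - D) k, a j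
      ≤ ∑ j ∈ range n, (D + 1) * (2 * j + 2 + D) / 2 * a j := by
  have hswap : ∑ k ∈ range n, ((k : ℝ) + 1) * ∑ j ∈ Icc (k - D) k, a j
      = ∑ j ∈ range n, ∑ k ∈ (Icc j (j + D)).filter (· < n), ((k : ℝ) + 1) * a j := by
    simp_rw [Finset.mul_sum]
    refine Finset.sum_comm' fun k j => ?_
    simp only [mem_range, mem_Icc, mem_filter]
    omega
  rw [hswap]
  refine Finset.sum_le_sum fun j _ => ?_
  rw [← sum_Icc_add_one_cast, Finset.sum_mul]
  exact Finset.sum_le_sum_of_subset_of_nonneg (Finset.filter_subset _ _)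
    fun k _ _ => mul_nonneg (by positivity) (ha j)

/-- Summing the descent inequalities of a delayed proximal gradient method. -/
theorem mul_sub_le_of_delayed_descent {F V A B : ℕ → ℝ} {Fs h : ℝ} {D : ℕ} (hh : 0 < h)
    (hV : ∀ k, 0 ≤ V k) (hA : ∀ k, 0 ≤ A k) (hAB : ∀ k, h * ((D : ℝ) + 1) ^ 2 * A k ≤ B k)
    (hopt : ∀ k, F (k + 1) - Fs ≤ V k - V (k + 1) - B k / 2
      + h / 2 * ((D + 1) * ∑ j ∈ Icc (k - D) k, A j))
    (hdesc : ∀ k, F (k + 2) - F (k + 1) ≤ - B (k + 1)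
      + h / 2 * ((D + 1) * ∑ j ∈ Icc (k + 1 - D) (k + 1), A j))
    {K : ℕ} (hK : (D + 1) / 2 ≤ K) :
    ((K : ℝ) + 1) * (F (K + 1) - Fs) ≤
      ∑ k ∈ range (D / 2 + 1), (h * (2 * k + D) * ((D : ℝ) + 1) ^ 2 / 4 * A k - k * B k) + V 0 := by
  have hsum (K : ℕ) : ((K : ℝ) + 1) * (F (K + 1) - Fs) ≤ V 0 - V (K + 1)
      + ∑ k ∈ range (K + 1), (h / 2 * (D + 1) * ((k + 1) * ∑ j ∈ Icc (k - D) k, A j)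
        - (k + 1 / 2) * B k) := by
    induction K with
    | zero =>
      have := hopt 0
      simp at this ⊢
      linarith
    | succ K ih =>
      rw [Finset.sum_range_succ]
      have h1 := hopt (K + 1)
      have h2 := mul_le_mul_of_nonneg_left (hdesc K) (by positivity : (0 : ℝ) ≤ K + 1)
      push_cast at *
      rw [add_assoc K 1 1] at *
      norm_num at *
      linarith
  have hdouble := mul_le_mul_of_nonneg_left (sum_mul_sum_Icc_le hA D (K + 1))
    (by positivity : 0 ≤ h / 2 * (D + 1))
  have hbound : ∑ k ∈ range (K + 1), (h / 2 * (D + 1) * ((D + 1) * (2 * k + 2 + D) / 2 * A k)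
        - (k + 1 / 2) * B k)
      ≤ ∑ k ∈ range (K + 1), (h * (2 * k + D) * ((D : ℝ) + 1) ^ 2 / 4 * A k - k * B k) :=
    Finset.sum_le_sum fun k _ => by linarith [hAB k]
  have htail : ∑ k ∈ range (K + 1), (h * (2 * k + D) * ((D : ℝ) + 1) ^ 2 / 4 * A k - k * B k)
      ≤ ∑ k ∈ range (D / 2 + 1), (h * (2 * k + D) * ((D : ℝ) + 1) ^ 2 / 4 * A k - k * B k) := by
    rw [← neg_le_neg_iff, ← Finset.sum_neg_distrib, ← Finset.sum_neg_distrib]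
    refine Finset.sum_le_sum_of_subset_of_nonneg (Finset.range_subset_range.2 (by omega))
      fun k _ hk => ?_
    have hDk : (D : ℝ) ≤ 2 * k := by
      rw [mem_range] at hk
      exact_mod_cast (by omega : D ≤ 2 * k)
    have h1 := mul_le_mul_of_nonneg_left (hAB k) (Nat.cast_nonneg' (α := ℝ) k)
    have h2 := mul_nonneg (sub_nonneg.2 hDk)
      (mul_nonneg (mul_nonneg hh.le (sq_nonneg ((D : ℝ) + 1))) (hA k))
    linarith
  have := hsum K
  rw [Finset.sum_sub_distrib, ← Finset.mul_sum] at this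
  rw [Finset.sum_sub_distrib, ← Finset.mul_sum] at hbound
  linarith [hV (K + 1)]

/-- One step of the delayed block proximal gradient method compared with a point `v`. -/
theorem delayed_prox_step {N : ℕ} {dims : Fin N → ℕ} {h : ℝ}
    {P : Blk dims → ℝ} {gradP : Blk dims → Blk dims} (hPconv : ConvexOn ℝ Set.univ P)
    (hPdiff : ∀ x, HasGradientAt P (gradP x) x)
    (hLip : ∀ u v : Blk dims, ‖gradP u - gradP v‖ ≤ h * ‖u - v‖)
    {q : ∀ i : Fin N, EuclideanSpace ℝ (Fin (dims i)) → EReal} (hqconv : ∀ i, ERealConvexOn (q i))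
    {c : Fin N → ℝ} (hc : ∀ i, 0 < c i) {x y z : Blk dims}
    (hprox : ∀ i, ∀ v : EuclideanSpace ℝ (Fin (dims i)),
      q i (y i) + ((1 / (2 * c i) * ‖y i - (x i - c i • gradP z i)‖ ^ 2 : ℝ) : EReal)
        ≤ q i v + ((1 / (2 * c i) * ‖v - (x i - c i • gradP z i)‖ ^ 2 : ℝ) : EReal))
    {v : Blk dims} {p r : Fin N → ℝ} (hp : ∀ i, q i (y i) = p i) (hr : ∀ i, q i (v i) = r i) :
    (P y + ∑ i, p i) - (P v + ∑ i, r i) ≤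
      ∑ i, 1 / (2 * c i) * ‖x i - v i‖ ^ 2 - ∑ i, 1 / (2 * c i) * ‖y i - v i‖ ^ 2
        - ∑ i, 1 / (2 * c i) * ‖y i - x i‖ ^ 2 + h / 2 * ‖y - z‖ ^ 2 := by
  have h1 := hPconv.add_inner_gradient_le hPdiff z v
  have h2 := HasGradientAt.le_add_inner_add_norm_sq hPdiff hLip z y
  have h3 : ∑ i, (p i - r i) ≤ ∑ i, (⟪gradP z i, v i - y i⟫ + 1 / (2 * c i) * ‖x i - v i‖ ^ 2
      - 1 / (2 * c i) * ‖y i - v i‖ ^ 2 - 1 / (2 * c i) * ‖y i - x i‖ ^ 2) := by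
    refine Finset.sum_le_sum fun i _ => ?_
    have h4 := (hqconv i).sub_le_inner_of_isProx (hc i) (hprox i) (hp i) (hr i)
    have h5 : y i - (x i - c i • gradP z i) = (y i - x i) + c i • gradP z i := by abel
    have h6 : ‖x i - v i‖ ^ 2 = ‖(y i - x i) + (v i - y i)‖ ^ 2 := by
      rw [← norm_neg]
      congr 2
      abel
    rw [h5, inner_add_left, real_inner_smul_left] at h4
    rw [h6, norm_add_sq_real, norm_sub_rev (y i) (v i)]
    refine h4.trans (le_of_eq ?_)
    have := (hc i).ne'
    field_simp
    ring
  have h7 : ∑ i, ⟪gradP z i, v i - y i⟫ = ⟪gradP z, v - y⟫ := by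
    simp [PiLp.inner_apply]
  have h8 : ⟪gradP z, v - y⟫ = ⟪gradP z, v - z⟫ - ⟪gradP z, y - z⟫ := by
    rw [← inner_sub_right]
    congr 1
    abel
  simp only [Finset.sum_sub_distrib, Finset.sum_add_distrib, h7, h8] at h3
  linarith

/-- convergence of the asynchronous dual proximal gradient algorithm with
delays bounded by `D` and step-sizes satisfying `1/cᵢ ≥ h(D+1)²`: for `K ≥ ⌈D/2⌉`,
`Ψ(λ(K+1)) − Ψ(λ*) ≤ Λ/(K+1)` where
`Λ = Σ_{k=0}^{⌊D/2⌋} Σᵢ (h(2k+D)(D+1)²/4 − k/cᵢ)‖λᵢ(k+1) − λᵢ(k)‖²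
  + Σᵢ (1/(2cᵢ))‖λᵢ(0) − λ*ᵢ‖²`. -/
theorem stmt14 {N : ℕ} (dims : Fin N → ℕ) (h : ℝ) (hh : 0 < h)
    (P : Blk dims → ℝ) (gradP : Blk dims → Blk dims)
    (hPconv : ConvexOn ℝ Set.univ P)
    (hPdiff : ∀ x, HasGradientAt P (gradP x) x)
    (hLip : ∀ u v : Blk dims, ‖gradP u - gradP v‖ ≤ h * ‖u - v‖)
    (q : ∀ i : Fin N, EuclideanSpace ℝ (Fin (dims i)) → EReal)
    (hqproper : ∀ i, ProperE (q i)) (hqlsc : ∀ i, LowerSemicontinuous (q i))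
    (hqconv : ∀ i, ERealConvexOn (q i))
    (c : Fin N → ℝ) (hc : ∀ i, 0 < c i)
    (D : ℕ) (τ : ℕ → ℕ) (hτ : ∀ k : ℕ, τ k ≤ k ∧ k - τ k ≤ D)
    (lam : ℕ → Blk dims)
    (hiter : ∀ (k : ℕ) (i : Fin N), ∀ v : EuclideanSpace ℝ (Fin (dims i)),
      q i (lam (k + 1) i) +
          ((1 / (2 * c i) *
            ‖lam (k + 1) i - (lam k i - c i • gradP (lam (τ k)) i)‖ ^ 2 : ℝ) : EReal)
        ≤ q i v +
          ((1 / (2 * c i) * ‖v - (lam k i - c i • gradP (lam (τ k)) i)‖ ^ 2 : ℝ) : EReal))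
    (hstep : ∀ i, h * ((D : ℝ) + 1) ^ 2 ≤ 1 / c i)
    (lamstar : Blk dims)
    (hmin : ∀ x : Blk dims,
      (P lamstar : EReal) + ∑ i : Fin N, q i (lamstar i)
        ≤ (P x : EReal) + ∑ i : Fin N, q i (x i))
    (hfin : ∃ r : ℝ, (P (lam 0) : EReal) + ∑ i : Fin N, q i (lam 0 i) = (r : EReal)) :
    ∀ K : ℕ, (D + 1) / 2 ≤ K →
      ((P (lam (K + 1)) : EReal) + ∑ i : Fin N, q i (lam (K + 1) i)) -
          ((P lamstar : EReal) + ∑ i : Fin N, q i (lamstar i))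
        ≤ (((∑ k ∈ Finset.range (D / 2 + 1), ∑ i : Fin N,
                (h * (2 * (k : ℝ) + D) * ((D : ℝ) + 1) ^ 2 / 4 - (k : ℝ) / c i) *
                  ‖lam (k + 1) i - lam k i‖ ^ 2
              + ∑ i : Fin N, 1 / (2 * c i) * ‖lam 0 i - lamstar i‖ ^ 2) / ((K : ℝ) + 1)
            : ℝ) : EReal) := by
  have hbot i x : q i x ≠ ⊥ := (hqproper i).1 x
  have hsum_bot (x : Blk dims) : ∑ i, q i (x i) ≠ ⊥ :=
    EReal.finset_sum_ne_bot _ _ fun i _ => hbot i _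
  have hstar i : q i (lamstar i) = ((q i (lamstar i)).toReal : ℝ) := by
    obtain ⟨r, hr⟩ := hfin
    have h1 := (hmin (lam 0)).trans_eq hr
    have h2 : (P lamstar : EReal) + ∑ i, q i (lamstar i) ≠ ⊤ :=
      (h1.trans_lt (EReal.coe_lt_top r)).ne
    rw [EReal.add_ne_top_iff_ne_top₂ (EReal.coe_ne_bot _) (hsum_bot _)] at h2
    exact (EReal.coe_toReal (EReal.ne_top_of_finset_sum_ne_top _ _ (fun j _ => hbot j _) h2.2
      (Finset.mem_univ i)) (hbot i _)).symm
  have hlam k i : q i (lam (k + 1) i) = ((q i (lam (k + 1) i)).toReal : ℝ) := by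
    refine (EReal.coe_toReal ?_ (hbot i _)).symm
    have h1 := hiter k i (lamstar i)
    rw [hstar i, ← EReal.coe_add] at h1
    intro htop
    rw [htop, EReal.top_add_coe] at h1
    exact absurd (h1.trans_lt (EReal.coe_lt_top _)) (lt_irrefl _)
  have hdelay k := mul_le_mul_of_nonneg_left
    (norm_sub_sq_le_sum_Icc lam (hτ k).1 (hτ k).2) (by positivity : 0 ≤ h / 2)
  have hhalf k : ∑ i, 1 / (2 * c i) * ‖lam (k + 1) i - lam k i‖ ^ 2
      = (∑ i, 1 / c i * ‖lam (k + 1) i - lam k i‖ ^ 2) / 2 := by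
    rw [Finset.sum_div]
    exact Finset.sum_congr rfl fun i _ => by ring
  intro K hK
  have main := mul_sub_le_of_delayed_descent
    (F := fun k => P (lam k) + ∑ i, (q i (lam k i)).toReal)
    (Fs := P lamstar + ∑ i, (q i (lamstar i)).toReal)
    (V := fun k => ∑ i, 1 / (2 * c i) * ‖lam k i - lamstar i‖ ^ 2)
    (A := fun k => ‖lam (k + 1) - lam k‖ ^ 2)
    (B := fun k => ∑ i, 1 / c i * ‖lam (k + 1) i - lam k i‖ ^ 2) (h := h) (D := D) hh
    (fun k => Finset.sum_nonneg fun i _ => by have := hc i; positivity)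
    (fun k => sq_nonneg _)
    (fun k => by
      rw [PiLp.norm_sq_eq_of_L2, Finset.mul_sum]
      exact Finset.sum_le_sum fun i _ => mul_le_mul_of_nonneg_right (hstep i) (sq_nonneg _))
    (fun k => by
      have := delayed_prox_step hPconv hPdiff hLip hqconv hc (hiter k) (hlam k) hstar
      rw [hhalf] at this
      linarith [hdelay k])
    (fun k => by
      have := delayed_prox_step hPconv hPdiff hLip hqconv hc (hiter (k + 1)) (hlam (k + 1))
        (hlam k)
      simp only [sub_self, norm_zero] at this
      norm_num at this
      have h2 := hdelay (k + 1)
      have h3 := hhalf (k + 1)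
      norm_num at h2 h3 ⊢
      linarith)
    hK
  have hcoe : ((P (lam (K + 1)) : EReal) + ∑ i : Fin N, q i (lam (K + 1) i)) -
      ((P lamstar : EReal) + ∑ i : Fin N, q i (lamstar i))
      = (((P (lam (K + 1)) + ∑ i, (q i (lam (K + 1) i)).toReal)
        - (P lamstar + ∑ i, (q i (lamstar i)).toReal) : ℝ) : EReal) := by
    rw [EReal.coe_sub, EReal.coe_add, EReal.coe_add, EReal.coe_finset_sum, EReal.coe_finset_sum,
      Finset.sum_congr rfl fun i _ => hlam K i, Finset.sum_congr rfl fun i _ => hstar i]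
  rw [hcoe, EReal.coe_le_coe_iff, le_div_iff₀ (by positivity), mul_comm]
  refine main.trans_eq ?_
  congr 1
  refine Finset.sum_congr rfl fun k _ => ?_
  rw [PiLp.norm_sq_eq_of_L2, Finset.mul_sum, Finset.mul_sum, ← Finset.sum_sub_distrib]
  refine Finset.sum_congr rfl fun i _ => ?_
  rw [PiLp.sub_apply]
  ring
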